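/- Let k be a commutative Artinian ring and A an associative unital k-algebra that is finitely generated as a k-module (an Artin algebra). If D and D' are integrable ([1,∞]-integrable) k-derivations on A, then the commutator [D,D'] = D∘D' − D'∘D is an integrable k-derivation; that is, the integrable derivations form a Lie subalgebra of the Lie algebra of all k-derivations on A. -/

import Mathlib

/-- A `k`-derivation on an associative unital `k`-algebra `A`: a `k`-linear map
satisfying the Leibniz rule. -/
def IsDerivation (k A : Type*) [CommRing k] [Ring A] [Algebra k A]
    (D : A →ₗ[k] A) : Prop :=
  ∀ x y : A, D (x * y) = D x * y + x * D y

/-- `D` is `[m,n)`-integrable: there is a family `α_0 = id, α_1, …, α_{n-1}` of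
`k`-linear endomorphisms of `A` with `α_i = 0` for `0 < i < m`, `α_m = D`, and
satisfying the Hasse–Schmidt convolution identities for all `i < n`. -/
def IsFinIntegrable (k A : Type*) [CommRing k] [Ring A] [Algebra k A]
    (m n : ℕ) (D : A →ₗ[k] A) : Prop :=
  ∃ α : ℕ → (A →ₗ[k] A),
    α 0 = LinearMap.id ∧
    (∀ i, 0 < i → i < m → α i = 0) ∧
    α m = D ∧
    ∀ i, i < n → ∀ x y : A,
      α i (x * y) = ∑ j ∈ Finset.range (i + 1), α j x * α (i - j) y

/-- `D` is `[m,∞]`-integrable: an infinite Hasse–Schmidt family exists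
(equivalently, an automorphism of `A⟦t⟧` congruent to `1` mod `t^m` with
`t^m`-coefficient `D`). -/
def IsInfIntegrable (k A : Type*) [CommRing k] [Ring A] [Algebra k A]
    (m : ℕ) (D : A →ₗ[k] A) : Prop :=
  ∃ α : ℕ → (A →ₗ[k] A),
    α 0 = LinearMap.id ∧
    (∀ i, 0 < i → i < m → α i = 0) ∧
    α m = D ∧
    ∀ i, ∀ x y : A,
      α i (x * y) = ∑ j ∈ Finset.range (i + 1), α j x * α (i - j) y

namespace HasseSchmidt

open Finset MvPowerSeries

variable {k A : Type*} [CommRing k] [Ring A] [Algebra k A] {σ : Type*}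

open Classical in
/-- The failure of multiplicativity of `f` in degree `ν`. -/
noncomputable def defect (f : MvPowerSeries σ (Module.End k A)) (ν : σ →₀ ℕ) : A → A → A :=
  fun x y => coeff ν f (x * y) - ∑ p ∈ antidiagonal ν, coeff p.1 f x * coeff p.2 f y

/-- `f` has constant term `1` and is multiplicative in all degrees in `S`. -/
structure HSOn (f : MvPowerSeries σ (Module.End k A)) (S : Set (σ →₀ ℕ)) : Prop where
  constantCoeff : constantCoeff f = 1
  defect_eq_zero : ∀ ν ∈ S, defect f ν = 0

lemma HSOn.mono {f : MvPowerSeries σ (Module.End k A)} {S S' : Set (σ →₀ ℕ)}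
    (hf : HSOn f S) (h : S' ⊆ S) : HSOn f S' :=
  ⟨hf.1, fun ν hν => hf.2 ν (h hν)⟩

lemma HSOn.coeff_zero {f : MvPowerSeries σ (Module.End k A)} {S : Set (σ →₀ ℕ)}
    (hf : HSOn f S) : coeff 0 f = 1 := hf.1

open Classical in
lemma apply_mul_eq (f : MvPowerSeries σ (Module.End k A)) (ν : σ →₀ ℕ) (x y : A) :
    coeff ν f (x * y) =
      ∑ p ∈ antidiagonal ν, coeff p.1 f x * coeff p.2 f y + defect f ν x y := by
  simp [defect]

open Classical in
/-- Interchange of the middle indices in a fourfold convolution. -/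
lemma sum_antidiagonal_interchange {M : Type*} [AddCommMonoid M] (T : σ →₀ ℕ)
    (F : (σ →₀ ℕ) → (σ →₀ ℕ) → (σ →₀ ℕ) → (σ →₀ ℕ) → M) :
    ∑ p ∈ antidiagonal T, ∑ q ∈ antidiagonal p.1, ∑ r ∈ antidiagonal p.2, F q.1 q.2 r.1 r.2 =
    ∑ p ∈ antidiagonal T, ∑ q ∈ antidiagonal p.1, ∑ r ∈ antidiagonal p.2,
      F q.1 r.1 q.2 r.2 := by
  simp only [← Finset.sum_product', Finset.sum_sigma']
  refine Finset.sum_nbij'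
    (fun z => ⟨(z.2.1.1 + z.2.2.1, z.2.1.2 + z.2.2.2),
      ((z.2.1.1, z.2.2.1), (z.2.1.2, z.2.2.2))⟩)
    (fun z => ⟨(z.2.1.1 + z.2.2.1, z.2.1.2 + z.2.2.2),
      ((z.2.1.1, z.2.2.1), (z.2.1.2, z.2.2.2))⟩) ?_ ?_ ?_ ?_ ?_
  · rintro ⟨⟨a, b⟩, ⟨c, d⟩, ⟨e, g⟩⟩ h
    simp only [mem_sigma, mem_product, HasAntidiagonal.mem_antidiagonal] at h ⊢
    obtain ⟨h1, h2, h3⟩ := h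
    refine ⟨?_, trivial, trivial⟩
    rw [← h1, ← h2, ← h3]; abel
  · rintro ⟨⟨a, b⟩, ⟨c, d⟩, ⟨e, g⟩⟩ h
    simp only [mem_sigma, mem_product, HasAntidiagonal.mem_antidiagonal] at h ⊢
    obtain ⟨h1, h2, h3⟩ := h
    refine ⟨?_, trivial, trivial⟩
    rw [← h1, ← h2, ← h3]; abel
  · rintro ⟨⟨a, b⟩, ⟨c, d⟩, ⟨e, g⟩⟩ h
    simp only [mem_sigma, mem_product, HasAntidiagonal.mem_antidiagonal] at h ⊢
    obtain ⟨-, rfl, rfl⟩ := h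
    rfl
  · rintro ⟨⟨a, b⟩, ⟨c, d⟩, ⟨e, g⟩⟩ h
    simp only [mem_sigma, mem_product, HasAntidiagonal.mem_antidiagonal] at h ⊢
    obtain ⟨-, rfl, rfl⟩ := h
    rfl
  · rintro ⟨⟨a, b⟩, ⟨c, d⟩, ⟨e, g⟩⟩ h
    rfl

lemma defect_congr {f g : MvPowerSeries σ (Module.End k A)} {T : σ →₀ ℕ}
    (h : ∀ ν ≤ T, coeff ν f = coeff ν g) : defect f T = defect g T := by
  classical
  funext x y
  unfold defect
  rw [h T le_rfl]
  congr 1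
  refine Finset.sum_congr rfl fun p hp => ?_
  rw [HasAntidiagonal.mem_antidiagonal] at hp
  rw [h p.1 (hp ▸ le_self_add), h p.2 (hp ▸ le_add_self)]

lemma defect_zero {f : MvPowerSeries σ (Module.End k A)} (hf : constantCoeff f = 1) :
    defect f 0 = 0 := by
  classical
  funext x y
  simp [defect, hf]

lemma defect_mul {f g : MvPowerSeries σ (Module.End k A)} {T : σ →₀ ℕ}
    (hf : HSOn f (Set.Iio T)) (hg : HSOn g (Set.Iio T)) :
    defect (f * g) T = defect f T + defect g T := by
  classical
  funext x y
  have key : coeff T (f * g) (x * y) =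
      ∑ p ∈ antidiagonal T, coeff p.1 (f * g) x * coeff p.2 (f * g) y
        + defect f T x y + defect g T x y := by
    rw [coeff_mul]
    simp only [LinearMap.sum_apply, Module.End.mul_apply]
    simp_rw [apply_mul_eq g, map_add, map_sum, apply_mul_eq f, Finset.sum_add_distrib]
    congr 1
    · congr 1
      · simp_rw [coeff_mul, LinearMap.sum_apply, Module.End.mul_apply, Finset.sum_mul_sum]
        rw [sum_antidiagonal_interchange T
          (fun a b c d => coeff a f (coeff b g x) * coeff c f (coeff d g y))]
        refine Finset.sum_congr rfl fun p _ => ?_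
        rw [Finset.sum_comm]
      · rw [Finset.sum_eq_single (T, 0)]
        · simp [hg.constantCoeff]
        · rintro ⟨a, b⟩ hab hne
          have hlt : a < T := by
            rw [HasAntidiagonal.mem_antidiagonal] at hab
            refine lt_of_le_of_ne (hab ▸ le_self_add) ?_
            rintro rfl
            exact hne (by simpa using hab)
          refine Finset.sum_eq_zero fun q _ => ?_
          rw [hf.2 a hlt]; rfl
        · simp
    · rw [Finset.sum_eq_single (0, T)]
      · simp [hf.constantCoeff]
      · rintro ⟨a, b⟩ hab hne
        have hlt : b < T := by
          rw [HasAntidiagonal.mem_antidiagonal] at hab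
          refine lt_of_le_of_ne (hab ▸ le_add_self) ?_
          rintro rfl
          exact hne (by simpa using hab)
        rw [hg.2 b hlt]; simp
      · simp
  simp only [defect, Pi.add_apply] at key ⊢
  rw [key]
  abel

lemma HSOn.mul {f g : MvPowerSeries σ (Module.End k A)} {S : Set (σ →₀ ℕ)}
    (hS : IsLowerSet S) (hf : HSOn f S) (hg : HSOn g S) : HSOn (f * g) S := by
  refine ⟨by rw [map_mul, hf.1, hg.1, one_mul], fun ν hν => ?_⟩
  have h : Set.Iio ν ⊆ S := fun a ha => hS (le_of_lt ha) hν
  rw [defect_mul (hf.mono h) (hg.mono h), hf.2 ν hν, hg.2 ν hν, add_zero]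

lemma defect_one (T : σ →₀ ℕ) : defect (1 : MvPowerSeries σ (Module.End k A)) T = 0 := by
  classical
  funext x y
  simp only [defect, coeff_one, Pi.zero_apply]
  split_ifs with h
  · subst h; simp
  · rw [Finset.sum_eq_zero]
    · simp
    · rintro ⟨a, b⟩ hab
      rw [HasAntidiagonal.mem_antidiagonal] at hab
      by_cases ha : a = 0
      · by_cases hb : b = 0
        · exact absurd (by rw [← hab, ha, hb, add_zero]) h
        · simp [hb]
      · simp [ha]

lemma HSOn.one (S : Set (σ →₀ ℕ)) : HSOn (1 : MvPowerSeries σ (Module.End k A)) S :=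
  ⟨map_one _, fun ν _ => defect_one ν⟩

/-- The inverse of a series with constant term `1`. -/
noncomputable def inv (f : MvPowerSeries σ (Module.End k A)) : MvPowerSeries σ (Module.End k A) :=
  invOfUnit f 1

lemma mul_inv {f : MvPowerSeries σ (Module.End k A)} (hf : constantCoeff f = 1) :
    f * inv f = 1 := mul_invOfUnit f 1 (by simpa using hf)

lemma inv_mul {f : MvPowerSeries σ (Module.End k A)} (hf : constantCoeff f = 1) :
    inv f * f = 1 := invOfUnit_mul f 1 (by simpa using hf)

lemma constantCoeff_inv (f : MvPowerSeries σ (Module.End k A)) :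
    constantCoeff (inv f) = 1 := by simp [inv]

lemma HSOn.inv [Finite σ] {f : MvPowerSeries σ (Module.End k A)} {S : Set (σ →₀ ℕ)}
    (hS : IsLowerSet S) (hf : HSOn f S) : HSOn (inv f) S := by
  refine ⟨constantCoeff_inv f, fun ν => ?_⟩
  induction ν using WellFoundedLT.induction with
  | ind ν ih =>
    intro hν
    have h : Set.Iio ν ⊆ S := fun a ha => hS (le_of_lt ha) hν
    have := defect_mul (hf.mono h) ⟨constantCoeff_inv f, fun a ha => ih a ha (h ha)⟩
    rwa [mul_inv hf.1, defect_one, hf.2 ν hν, zero_add, eq_comm] at this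

lemma defect_inv [Finite σ] {f : MvPowerSeries σ (Module.End k A)} {T : σ →₀ ℕ}
    (hf : HSOn f (Set.Iio T)) : defect (HasseSchmidt.inv f) T = -defect f T := by
  have := defect_mul hf (hf.inv (isLowerSet_Iio T))
  rw [mul_inv hf.1, defect_one] at this
  exact eq_neg_of_add_eq_zero_right this.symm

/-- The substitution of a series `h` without constant term for the variable of `f`. -/
noncomputable def subst (h : MvPowerSeries σ k) (f : MvPowerSeries Unit (Module.End k A)) :
    MvPowerSeries σ (Module.End k A) :=
  fun ν => ∑ n ∈ range (ν.degree + 1), coeff ν (h ^ n) • coeff (Finsupp.single () n) f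

lemma coeff_subst {h : MvPowerSeries σ k} (hh : constantCoeff h = 0)
    (f : MvPowerSeries Unit (Module.End k A)) (ν : σ →₀ ℕ) {B : ℕ} (hB : ν.degree < B) :
    coeff ν (subst h f) =
      ∑ n ∈ range B, coeff ν (h ^ n) • coeff (Finsupp.single () n) f := by
  refine Finset.sum_subset (Finset.range_mono hB) fun n _ hn => ?_
  rw [coeff_eq_zero_of_constantCoeff_nilpotent (m := 1) (by simpa using hh), zero_smul]
  simp at hn
  omega

lemma sum_antidiagonal_single {_ : DecidableEq Unit} {M : Type*} [AddCommMonoid M] (n : ℕ)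
    (F : (Unit →₀ ℕ) → (Unit →₀ ℕ) → M) :
    ∑ p ∈ antidiagonal (Finsupp.single () n), F p.1 p.2 =
      ∑ p ∈ antidiagonal n, F (Finsupp.single () p.1) (Finsupp.single () p.2) := by
  refine Finset.sum_nbij' (fun p => (p.1 (), p.2 ()))
    (fun p => (Finsupp.single () p.1, Finsupp.single () p.2)) ?_ ?_ ?_ ?_ ?_
  · rintro ⟨a, b⟩ h
    simp only [HasAntidiagonal.mem_antidiagonal] at h ⊢
    simpa using DFunLike.congr_fun h ()
  · rintro ⟨a, b⟩ h
    simp only [HasAntidiagonal.mem_antidiagonal] at h ⊢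
    rw [← Finsupp.single_add, h]
  · rintro ⟨a, b⟩ _
    ext <;> simp
  · rintro ⟨a, b⟩ _
    simp
  · rintro ⟨a, b⟩ _
    congr 1 <;> ext <;> simp

lemma defect_subst {h : MvPowerSeries σ k} (hh : constantCoeff h = 0)
    (f : MvPowerSeries Unit (Module.End k A)) (ν : σ →₀ ℕ) (x y : A) :
    defect (subst h f) ν x y = ∑ n ∈ range (ν.degree + 1),
      coeff ν (h ^ n) • defect f (Finsupp.single () n) x y := by
  classical
  set B := ν.degree + 1 with hB
  set c : ℕ → Module.End k A := fun n => coeff (Finsupp.single () n) f with hc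
  have hsub : ∀ a ≤ ν, ∀ z, coeff a (subst h f) z =
      ∑ n ∈ range B, coeff a (h ^ n) • c n z := by
    intro a ha z
    rw [coeff_subst hh f a (B := B) (Nat.lt_succ_of_le (Finsupp.degree_mono ha))]
    simp [LinearMap.sum_apply, hc]
  have h1 : ∑ p ∈ antidiagonal ν, coeff p.1 (subst h f) x * coeff p.2 (subst h f) y =
      ∑ m ∈ range B, ∑ n ∈ range B, coeff ν (h ^ (m + n)) • (c m x * c n y) := by
    have : ∀ p ∈ antidiagonal ν, coeff p.1 (subst h f) x * coeff p.2 (subst h f) y =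
        ∑ m ∈ range B, ∑ n ∈ range B,
          (coeff p.1 (h ^ m) * coeff p.2 (h ^ n)) • (c m x * c n y) := by
      intro p hp
      rw [HasAntidiagonal.mem_antidiagonal] at hp
      rw [hsub p.1 (hp ▸ le_self_add), hsub p.2 (hp ▸ le_add_self), Finset.sum_mul_sum]
      simp only [smul_mul_smul_comm]
    rw [Finset.sum_congr rfl this, Finset.sum_comm]
    refine Finset.sum_congr rfl fun m _ => ?_
    rw [Finset.sum_comm]
    refine Finset.sum_congr rfl fun n _ => ?_
    rw [← Finset.sum_smul, pow_add, coeff_mul]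
  have h2 : ∑ m ∈ range B, ∑ n ∈ range B, coeff ν (h ^ (m + n)) • (c m x * c n y) =
      ∑ N ∈ range B, ∑ p ∈ antidiagonal N, coeff ν (h ^ N) • (c p.1 x * c p.2 y) := by
    rw [← Finset.sum_product', Finset.sum_sigma']
    symm
    refine Finset.sum_of_injOn (fun z => z.2) ?_ ?_ ?_ ?_
    · rintro ⟨N, a, b⟩ hz ⟨N', a', b'⟩ hz' heq
      simp only [coe_sigma, Set.mem_sigma_iff, mem_coe,
        HasAntidiagonal.mem_antidiagonal] at hz hz' heq
      obtain ⟨rfl, rfl⟩ := Prod.mk.inj heq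
      obtain ⟨-, rfl⟩ := hz
      obtain ⟨-, rfl⟩ := hz'
      rfl
    · rintro ⟨N, a, b⟩ hz
      simp at hz ⊢
      omega
    · rintro ⟨a, b⟩ _ hn
      have hab : ν.degree + 1 ≤ a + b := by
        by_contra hlt
        exact hn ⟨⟨a + b, a, b⟩, by simp; omega, rfl⟩
      rw [coeff_eq_zero_of_constantCoeff_nilpotent (m := 1) (by simpa using hh) (by omega),
        zero_smul]
    · rintro ⟨N, a, b⟩ hz
      simp only [mem_sigma, HasAntidiagonal.mem_antidiagonal] at hz
      rw [hz.2]
  unfold defect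
  rw [h1, h2, hsub ν le_rfl, ← Finset.sum_sub_distrib]
  refine Finset.sum_congr rfl fun n _ => ?_
  rw [smul_sub, ← Finset.smul_sum,
    sum_antidiagonal_single n (fun a b => coeff a f x * coeff b f y)]

lemma constantCoeff_subst {h : MvPowerSeries σ k}
    {f : MvPowerSeries Unit (Module.End k A)} (hf : constantCoeff f = 1) :
    constantCoeff (subst h f) = 1 := by
  rw [← coeff_zero_eq_constantCoeff_apply]
  change ∑ n ∈ range ((0 : σ →₀ ℕ).degree + 1), _ = _
  simp [hf]

lemma single_lt_single {m n : ℕ} : Finsupp.single () m < Finsupp.single () n ↔ m < n := by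
  rw [lt_iff_le_not_ge, lt_iff_le_not_ge]
  simp

lemma HSOn.subst {h : MvPowerSeries σ k} (hh : MvPowerSeries.constantCoeff h = 0)
    {f : MvPowerSeries Unit (Module.End k A)} {q : ℕ}
    (hf : HSOn f (Set.Iio (Finsupp.single () q))) {S : Set (σ →₀ ℕ)}
    (hS : ∀ ν ∈ S, ∀ n, q ≤ n → coeff ν (h ^ n) = 0) : HSOn (subst h f) S := by
  refine ⟨constantCoeff_subst hf.1, fun ν hν => ?_⟩
  funext x y
  rw [defect_subst hh]
  refine Finset.sum_eq_zero fun n _ => ?_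
  rcases lt_or_ge n q with hn | hn
  · rw [hf.2 _ (single_lt_single.2 hn)]; simp
  · rw [hS ν hν n hn, zero_smul]

lemma nsmul_inj {μ : σ →₀ ℕ} (hμ : μ ≠ 0) {m n : ℕ} : m • μ = n • μ ↔ m = n := by
  refine ⟨fun h => ?_, fun h => by rw [h]⟩
  have h' := congrArg Finsupp.degree h
  simp only [map_nsmul, smul_eq_mul] at h'
  exact Nat.eq_of_mul_eq_mul_right
    (Nat.pos_of_ne_zero fun h0 => hμ ((Finsupp.degree_eq_zero_iff μ).1 h0)) h'

lemma le_degree_nsmul {μ : σ →₀ ℕ} (hμ : μ ≠ 0) (n : ℕ) : n ≤ (n • μ).degree := by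
  simp only [map_nsmul, smul_eq_mul]
  exact Nat.le_mul_of_pos_right _
    (Nat.pos_of_ne_zero fun h0 => hμ ((Finsupp.degree_eq_zero_iff μ).1 h0))

lemma constantCoeff_monomial {μ : σ →₀ ℕ} (hμ : μ ≠ 0) (c : k) :
    constantCoeff (monomial μ c) = 0 := coeff_monomial_ne hμ.symm c

lemma coeff_subst_monomial {μ : σ →₀ ℕ} (hμ : μ ≠ 0) (c : k)
    (f : MvPowerSeries Unit (Module.End k A)) (n : ℕ) :
    coeff (n • μ) (subst (monomial μ c) f) = c ^ n • coeff (Finsupp.single () n) f := by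
  classical
  change ∑ m ∈ range ((n • μ).degree + 1),
    coeff (n • μ) (monomial μ c ^ m) • coeff (Finsupp.single () m) f = _
  rw [Finset.sum_eq_single n]
  · rw [monomial_pow, coeff_monomial_same]
  · intro m _ hm
    rw [monomial_pow, coeff_monomial_ne (fun h => hm ((nsmul_inj hμ).1 h).symm), zero_smul]
  · intro h
    have := le_degree_nsmul hμ n
    simp only [mem_range] at h
    omega

lemma coeff_subst_monomial_of_ne {μ : σ →₀ ℕ} (c : k)
    (f : MvPowerSeries Unit (Module.End k A)) {ν : σ →₀ ℕ} (hν : ∀ n : ℕ, ν ≠ n • μ) :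
    coeff ν (subst (monomial μ c) f) = 0 := by
  classical
  change ∑ m ∈ range (ν.degree + 1),
    coeff ν (monomial μ c ^ m) • coeff (Finsupp.single () m) f = 0
  refine Finset.sum_eq_zero fun m _ => ?_
  rw [monomial_pow, coeff_monomial_ne (hν m), zero_smul]

lemma defect_subst_monomial {μ : σ →₀ ℕ} (hμ : μ ≠ 0) (c : k)
    (f : MvPowerSeries Unit (Module.End k A)) (n : ℕ) :
    defect (subst (monomial μ c) f) (n • μ) = c ^ n • defect f (Finsupp.single () n) := by
  classical
  funext x y
  rw [defect_subst (constantCoeff_monomial hμ c), Finset.sum_eq_single n]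
  · rw [monomial_pow, coeff_monomial_same]; rfl
  · intro m _ hm
    rw [monomial_pow, coeff_monomial_ne (fun h => hm ((nsmul_inj hμ).1 h).symm), zero_smul]
  · intro h
    have := le_degree_nsmul hμ n
    simp only [mem_range] at h
    omega

lemma defect_subst_monomial_of_ne {μ : σ →₀ ℕ} (hμ : μ ≠ 0) (c : k)
    (f : MvPowerSeries Unit (Module.End k A)) {ν : σ →₀ ℕ} (hν : ∀ n : ℕ, ν ≠ n • μ) :
    defect (subst (monomial μ c) f) ν = 0 := by
  funext x y
  rw [defect_subst (constantCoeff_monomial hμ c)]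
  refine Finset.sum_eq_zero fun m _ => ?_
  rw [monomial_pow, coeff_monomial_ne (hν m), zero_smul]

lemma HSOn.subst_monomial {μ : σ →₀ ℕ} (hμ : μ ≠ 0) (c : k)
    {f : MvPowerSeries Unit (Module.End k A)} {q : ℕ}
    (hf : HSOn f (Set.Iio (Finsupp.single () q))) {S : Set (σ →₀ ℕ)}
    (hS : ∀ n : ℕ, n • μ ∈ S → n < q) :
    HSOn (HasseSchmidt.subst (monomial μ c) f) S := by
  refine hf.subst (constantCoeff_monomial hμ c) fun ν hν n hn => ?_
  rw [monomial_pow]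
  refine coeff_monomial_ne ?_ _
  rintro rfl
  exact absurd (hS n hν) (by omega)

/-- The exponent of `X₀ ^ a * X₁ ^ b`. -/
noncomputable def pt (a b : ℕ) : Fin 2 →₀ ℕ := Finsupp.single 0 a + Finsupp.single 1 b

@[simp] lemma pt_zero (a b : ℕ) : pt a b 0 = a := by simp [pt]

@[simp] lemma pt_one (a b : ℕ) : pt a b 1 = b := by simp [pt]

lemma pt_eta (ν : Fin 2 →₀ ℕ) : pt (ν 0) (ν 1) = ν := by
  ext i; fin_cases i <;> simp

lemma pt_inj {a b c d : ℕ} : pt a b = pt c d ↔ a = c ∧ b = d := by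
  refine ⟨fun h => ⟨?_, ?_⟩, ?_⟩
  · simpa using DFunLike.congr_fun h 0
  · simpa using DFunLike.congr_fun h 1
  · rintro ⟨rfl, rfl⟩; rfl

lemma le_iff_fin_two {μ ν : Fin 2 →₀ ℕ} : μ ≤ ν ↔ μ 0 ≤ ν 0 ∧ μ 1 ≤ ν 1 := by
  rw [Finsupp.le_def, Fin.forall_fin_two]

lemma degree_fin_two (ν : Fin 2 →₀ ℕ) : ν.degree = ν 0 + ν 1 := by
  simp [Finsupp.degree_eq_sum]

lemma coeff_X_add_X_pow (ν : Fin 2 →₀ ℕ) (n : ℕ) :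
    coeff ν ((X 0 + X 1 : MvPowerSeries (Fin 2) k) ^ n) =
      if n = ν.degree then (n.choose (ν 0) : k) else 0 := by
  classical
  have hm : ∀ m ∈ range (n + 1), (X 0 : MvPowerSeries (Fin 2) k) ^ m * X 1 ^ (n - m) *
      (n.choose m : MvPowerSeries (Fin 2) k) = monomial (pt m (n - m)) (n.choose m : k) := by
    intro m _
    rw [X_pow_eq, X_pow_eq, monomial_mul_monomial, one_mul, ← map_natCast (C (σ := Fin 2)),
      ← monomial_zero_eq_C_apply, monomial_mul_monomial, add_zero, one_mul]
    rfl
  rw [add_pow, Finset.sum_congr rfl hm, map_sum]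
  simp_rw [coeff_monomial]
  have hν : ∀ m, ν = pt m (n - m) ↔ m = ν 0 ∧ n - m = ν 1 := by
    intro m
    rw [← pt_eta ν, pt_inj]
    simp [eq_comm]
  simp_rw [hν, degree_fin_two]
  split_ifs with h
  · rw [Finset.sum_eq_single (ν 0)]
    · rw [if_pos ⟨rfl, by omega⟩]
    · intro m _ hne
      rw [if_neg fun h => hne h.1]
    · intro h'
      simp only [mem_range] at h'
      omega
  · refine Finset.sum_eq_zero fun m hm => if_neg ?_
    rintro ⟨h1, h2⟩
    simp only [mem_range] at hm
    omega

lemma constantCoeff_X_add_X : constantCoeff (X 0 + X 1 : MvPowerSeries (Fin 2) k) = 0 := by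
  simp

lemma defect_subst_X_add_X (f : MvPowerSeries Unit (Module.End k A)) (ν : Fin 2 →₀ ℕ) :
    defect (subst (X 0 + X 1) f) ν =
      ν.degree.choose (ν 0) • defect f (Finsupp.single () ν.degree) := by
  funext x y
  rw [defect_subst constantCoeff_X_add_X, Finset.sum_eq_single ν.degree]
  · rw [coeff_X_add_X_pow, if_pos rfl, Nat.cast_smul_eq_nsmul]; rfl
  · intro m _ hm
    rw [coeff_X_add_X_pow, if_neg hm, zero_smul]
  · simp

lemma HSOn.subst_X_add_X {f : MvPowerSeries Unit (Module.End k A)} {q : ℕ}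
    (hf : HSOn f (Set.Iio (Finsupp.single () q))) {S : Set (Fin 2 →₀ ℕ)}
    (hS : ∀ ν ∈ S, ν.degree < q) : HSOn (HasseSchmidt.subst (X 0 + X 1) f) S := by
  refine hf.subst constantCoeff_X_add_X fun ν hν n hn => ?_
  have := hS ν hν
  rw [coeff_X_add_X_pow, if_neg (by omega)]

lemma coeff_mul_congr {f g : MvPowerSeries σ (Module.End k A)}
    (h : MvPowerSeries σ (Module.End k A)) {ν : σ →₀ ℕ} (hfg : ∀ ν' ≤ ν, coeff ν' f = coeff ν' g) :
    coeff ν (h * f) = coeff ν (h * g) := by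
  classical
  rw [coeff_mul, coeff_mul]
  refine Finset.sum_congr rfl fun p hp => ?_
  rw [HasAntidiagonal.mem_antidiagonal] at hp
  rw [hfg p.2 (hp ▸ le_add_self)]

lemma coeff_inv_mul_eq_zero {f g : MvPowerSeries σ (Module.End k A)}
    (hg : constantCoeff g = 1) {ν : σ →₀ ℕ} (hν : ν ≠ 0)
    (h : ∀ ν' ≤ ν, coeff ν' f = coeff ν' g) : coeff ν (inv g * f) = 0 := by
  classical
  rw [coeff_mul_congr _ h, inv_mul hg, coeff_one, if_neg hν]

lemma coeff_inv_mul {f g : MvPowerSeries σ (Module.End k A)}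
    (hg : constantCoeff g = 1) {ν : σ →₀ ℕ} (hν : ν ≠ 0)
    (h : ∀ ν' < ν, coeff ν' f = coeff ν' g) :
    coeff ν (inv g * f) = coeff ν f - coeff ν g := by
  classical
  have h1 : inv g * f = inv g * (f - g) + 1 := by rw [mul_sub, inv_mul hg]; abel
  rw [h1, map_add, coeff_one, if_neg hν, add_zero, coeff_mul, Finset.sum_eq_single (0, ν)]
  · rw [coeff_zero_eq_constantCoeff_apply, constantCoeff_inv, one_mul, map_sub]
  · rintro ⟨a, b⟩ hab hne
    rw [HasAntidiagonal.mem_antidiagonal] at hab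
    have hb : b < ν := by
      refine lt_of_le_of_ne (hab ▸ le_add_self) ?_
      rintro rfl
      exact hne (by simpa using hab)
    rw [map_sub, h b hb, sub_self, mul_zero]
  · simp

lemma lt_single_iff {ν : Unit →₀ ℕ} {n : ℕ} : ν < Finsupp.single () n ↔ ν () < n := by
  have : ν = Finsupp.single () (ν ()) := by ext; simp
  rw [this, single_lt_single]
  simp

lemma single_ne_zero {n : ℕ} (hn : n ≠ 0) : Finsupp.single () n ≠ 0 := by simpa using hn

lemma nsmul_single_one (n : ℕ) : n • Finsupp.single () 1 = Finsupp.single () n := by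
  ext; simp

lemma coeff_single_one_mul {f g : MvPowerSeries Unit (Module.End k A)}
    (hf : constantCoeff f = 1) (hg : constantCoeff g = 1) :
    coeff (Finsupp.single () 1) (f * g) =
      coeff (Finsupp.single () 1) f + coeff (Finsupp.single () 1) g := by
  classical
  rw [coeff_mul, sum_antidiagonal_single 1 (fun a b => coeff a f * coeff b g)]
  have hf0 : coeff (Finsupp.single () 0) f = 1 := by rw [Finsupp.single_zero]; exact hf
  have hg0 : coeff (Finsupp.single () 0) g = 1 := by rw [Finsupp.single_zero]; exact hg
  rw [show antidiagonal 1 = {(0, 1), (1, 0)} from rfl, Finset.sum_pair (by decide)]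
  rw [hf0, hg0, one_mul, mul_one, add_comm]

lemma coeff_single_one_inv {f : MvPowerSeries Unit (Module.End k A)}
    (hf : constantCoeff f = 1) :
    coeff (Finsupp.single () 1) (inv f) = -coeff (Finsupp.single () 1) f := by
  classical
  have h := coeff_single_one_mul hf (constantCoeff_inv f)
  rw [mul_inv hf, coeff_one, if_neg (single_ne_zero one_ne_zero)] at h
  exact eq_neg_of_add_eq_zero_right h.symm

variable (k A) in
/-- The obstructions in degree `q` to extending Hasse–Schmidt families of length `q`. -/
def obs (q : ℕ) : AddSubgroup (A → A → A) where
  carrier := {b | ∃ f : MvPowerSeries Unit (Module.End k A),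
    HSOn f (Set.Iio (Finsupp.single () q)) ∧ defect f (Finsupp.single () q) = b}
  zero_mem' := ⟨1, HSOn.one _, defect_one _⟩
  add_mem' := by
    rintro _ _ ⟨f, hf, rfl⟩ ⟨g, hg, rfl⟩
    exact ⟨f * g, hf.mul (isLowerSet_Iio _) hg, defect_mul hf hg⟩
  neg_mem' := by
    rintro _ ⟨f, hf, rfl⟩
    exact ⟨inv f, hf.inv (isLowerSet_Iio _), defect_inv hf⟩

variable (k A) in
/-- The obstructions in degree `q` coming from families with vanishing linear term. -/
def obsTwo (q : ℕ) : AddSubgroup (A → A → A) where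
  carrier := {b | ∃ f : MvPowerSeries Unit (Module.End k A),
    HSOn f (Set.Iio (Finsupp.single () q)) ∧ coeff (Finsupp.single () 1) f = 0 ∧
      defect f (Finsupp.single () q) = b}
  zero_mem' := by
    classical
    exact ⟨1, HSOn.one _, by rw [coeff_one, if_neg (single_ne_zero one_ne_zero)], defect_one _⟩
  add_mem' := by
    rintro _ _ ⟨f, hf, hf1, rfl⟩ ⟨g, hg, hg1, rfl⟩
    exact ⟨f * g, hf.mul (isLowerSet_Iio _) hg,
      by rw [coeff_single_one_mul hf.1 hg.1, hf1, hg1, add_zero], defect_mul hf hg⟩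
  neg_mem' := by
    rintro _ ⟨f, hf, hf1, rfl⟩
    exact ⟨inv f, hf.inv (isLowerSet_Iio _), by rw [coeff_single_one_inv hf.1, hf1, neg_zero],
      defect_inv hf⟩

lemma obs_le_of_dvd {d q : ℕ} (h : d ∣ q) (hq : q ≠ 0) : obs k A d ≤ obs k A q := by
  obtain ⟨e, rfl⟩ := h
  rintro _ ⟨f, hf, rfl⟩
  have he : e ≠ 0 := by rintro rfl; simp at hq
  have hde : Finsupp.single () (d * e) = d • Finsupp.single () e := by simp
  refine ⟨subst (monomial (Finsupp.single () e) 1) f,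
    hf.subst_monomial (single_ne_zero he) 1 fun n hn => ?_, ?_⟩
  · rw [Set.mem_Iio, lt_single_iff] at hn
    simp only [Finsupp.smul_single, Finsupp.single_eq_same, smul_eq_mul] at hn
    exact Nat.lt_of_mul_lt_mul_right hn
  · rw [hde, defect_subst_monomial (single_ne_zero he), one_pow, one_smul]

lemma obs_le_obsTwo {d q : ℕ} (h : d ∣ q) (hdq : d < q) : obs k A d ≤ obsTwo k A q := by
  obtain ⟨e, rfl⟩ := h
  rintro _ ⟨f, hf, rfl⟩
  have he : e ≠ 0 := by rintro rfl; simp at hdq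
  have he1 : e ≠ 1 := by rintro rfl; simp at hdq
  have hde : Finsupp.single () (d * e) = d • Finsupp.single () e := by simp
  refine ⟨subst (monomial (Finsupp.single () e) 1) f,
    hf.subst_monomial (single_ne_zero he) 1 fun n hn => ?_, ?_, ?_⟩
  · rw [Set.mem_Iio, lt_single_iff] at hn
    simp only [Finsupp.smul_single, Finsupp.single_eq_same, smul_eq_mul] at hn
    exact Nat.lt_of_mul_lt_mul_right hn
  · refine coeff_subst_monomial_of_ne 1 f fun n hn => he1 ?_
    have := DFunLike.congr_fun hn ()
    simp only [Finsupp.smul_single, Finsupp.single_eq_same, smul_eq_mul] at this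
    exact Nat.eq_one_of_mul_eq_one_left this.symm
  · rw [hde, defect_subst_monomial (single_ne_zero he), one_pow, one_smul]

variable (k A) in
/-- The linear terms of Hasse–Schmidt families of length `n`. -/
def integrable (n : ℕ) : Submodule k (Module.End k A) where
  carrier := {D | ∃ f : MvPowerSeries Unit (Module.End k A),
    HSOn f (Set.Iio (Finsupp.single () n)) ∧ coeff (Finsupp.single () 1) f = D}
  zero_mem' := by
    classical
    exact ⟨1, HSOn.one _, by rw [coeff_one, if_neg (single_ne_zero one_ne_zero)]⟩
  add_mem' := by
    rintro _ _ ⟨f, hf, rfl⟩ ⟨g, hg, rfl⟩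
    exact ⟨f * g, hf.mul (isLowerSet_Iio _) hg, coeff_single_one_mul hf.1 hg.1⟩
  smul_mem' := by
    rintro c _ ⟨f, hf, rfl⟩
    refine ⟨subst (monomial (Finsupp.single () 1) c) f,
      hf.subst_monomial (single_ne_zero one_ne_zero) c fun n' hn => ?_, ?_⟩
    · rwa [nsmul_single_one, Set.mem_Iio, single_lt_single] at hn
    · have := coeff_subst_monomial (single_ne_zero one_ne_zero) c f 1
      rwa [one_smul, pow_one] at this

lemma integrable_antitone : Antitone (integrable k A) := by
  rintro m n hmn _ ⟨f, hf, rfl⟩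
  refine ⟨f, hf.mono (Set.Iio_subset_Iio ?_), rfl⟩
  simpa using hmn

lemma mem_integrable_one (D : Module.End k A) : D ∈ integrable k A 1 := by
  let f : MvPowerSeries Unit (Module.End k A) := fun ν => if ν = 0 then 1 else D
  have hf : constantCoeff f = 1 := by
    change (if (0 : Unit →₀ ℕ) = 0 then (1 : Module.End k A) else D) = 1
    exact if_pos rfl
  refine ⟨f, ⟨hf, fun ν hν => ?_⟩, if_neg (single_ne_zero one_ne_zero)⟩
  rw [Set.mem_Iio, lt_single_iff, Nat.lt_one_iff] at hν
  have : ν = 0 := by ext; exact hν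
  rw [this, defect_zero hf]

lemma mem_integrable_succ {f : MvPowerSeries Unit (Module.End k A)} {q : ℕ}
    (hf : HSOn f (Set.Iio (Finsupp.single () q)))
    (h : defect f (Finsupp.single () q) ∈ obsTwo k A q) :
    coeff (Finsupp.single () 1) f ∈ integrable k A (q + 1) := by
  obtain ⟨g, hg, hg1, hgf⟩ := h
  have hig := hg.inv (isLowerSet_Iio _)
  refine ⟨f * inv g, ⟨(hf.mul (isLowerSet_Iio _) hig).1, fun ν hν => ?_⟩, ?_⟩
  · rw [Set.mem_Iio, lt_single_iff] at hν
    rcases Nat.lt_succ_iff_lt_or_eq.1 hν with h | h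
    · exact (hf.mul (isLowerSet_Iio _) hig).2 ν (lt_single_iff.2 h)
    · have : ν = Finsupp.single () q := by ext; simpa using h
      rw [this, defect_mul hf hig, defect_inv hg, hgf, add_neg_cancel]
  · rw [coeff_single_one_mul hf.1 hig.1, coeff_single_one_inv hg.1, hg1, neg_zero, add_zero]

/-- The elements that a multiple prime to `p` moves into `H`. -/
def saturation (p : ℕ) [hp : Fact p.Prime] {V : Type*} [AddCommGroup V] (H : AddSubgroup V) :
    AddSubgroup V where
  carrier := {b | ∃ N : ℕ, ¬ p ∣ N ∧ N • b ∈ H}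
  zero_mem' := ⟨1, hp.out.one_lt.ne' ∘ Nat.dvd_one.1, by simp⟩
  add_mem' := by
    rintro a b ⟨M, hM, ha⟩ ⟨N, hN, hb⟩
    refine ⟨M * N, fun h => (hp.out.dvd_mul.1 h).elim hM hN, ?_⟩
    rw [smul_add, mul_comm M N, mul_smul, mul_comm N M, mul_smul]
    exact add_mem (nsmul_mem ha N) (nsmul_mem hb M)
  neg_mem' := by
    rintro a ⟨M, hM, ha⟩
    exact ⟨M, hM, by rw [smul_neg]; exact neg_mem ha⟩

lemma le_saturation (p : ℕ) [hp : Fact p.Prime] {V : Type*} [AddCommGroup V]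
    (H : AddSubgroup V) : H ≤ saturation p H :=
  fun b hb => ⟨1, hp.out.one_lt.ne' ∘ Nat.dvd_one.1, by simpa using hb⟩

lemma mem_saturation_of_nsmul_mem {p : ℕ} [hp : Fact p.Prime] {V : Type*} [AddCommGroup V]
    {H : AddSubgroup V} {N : ℕ} (hN : ¬ p ∣ N) {b : V} (hb : N • b ∈ saturation p H) :
    b ∈ saturation p H := by
  obtain ⟨M, hM, h⟩ := hb
  exact ⟨M * N, fun h => (hp.out.dvd_mul.1 h).elim hM hN, by rwa [mul_smul]⟩

lemma saturation_mono (p : ℕ) [Fact p.Prime] {V : Type*} [AddCommGroup V]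
    {H K : AddSubgroup V} (h : H ≤ K) : saturation p H ≤ saturation p K :=
  fun _ ⟨N, hN, hb⟩ => ⟨N, hN, h hb⟩

lemma mem_of_forall_mem_saturation {V : Type*} [AddCommGroup V] {H : AddSubgroup V} {b : V}
    (h : ∀ (p : ℕ) [Fact p.Prime], b ∈ saturation p H) : b ∈ H := by
  rw [← QuotientAddGroup.eq_zero_iff, ← AddMonoid.addOrderOf_eq_one_iff]
  by_contra hne
  obtain ⟨p, hp, hdvd⟩ := Nat.exists_prime_and_dvd hne
  have := Fact.mk hp
  obtain ⟨N, hN, hb⟩ := h p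
  refine hN (hdvd.trans (addOrderOf_dvd_of_nsmul_eq_zero ?_))
  rw [← QuotientAddGroup.mk_nsmul, QuotientAddGroup.eq_zero_iff]
  exact hb

variable (k A) in
/-- The leading coefficient of a series in two variables which is multiplicative up to degree
`q • μ`, where `μ` is the leading degree for the weight `w`, is integrable to length `q + 1`. -/
def LeadingIntegrable (q : ℕ) : Prop :=
  ∀ (w : (Fin 2 →₀ ℕ) →+ ℕ) (μ : Fin 2 →₀ ℕ) (f : MvPowerSeries (Fin 2) (Module.End k A)),
    μ ≠ 0 → Set.InjOn w (Set.Iic (q • μ)) → HSOn f (Set.Iic (q • μ)) →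
    (∀ ν ≤ q • μ, ν ≠ 0 → w ν < w μ → coeff ν f = 0) → coeff μ f ∈ integrable k A (q + 1)

lemma weight_mono (w : (Fin 2 →₀ ℕ) →+ ℕ) : Monotone w := by
  intro a b hab
  obtain ⟨c, rfl⟩ := exists_add_of_le hab
  rw [map_add]
  exact Nat.le_add_right _ _

lemma coeff_inv_subst_mul_eq_zero {w : (Fin 2 →₀ ℕ) →+ ℕ} {T μ : Fin 2 →₀ ℕ}
    (hw : Set.InjOn w (Set.Iic T)) (hμ : μ ≠ 0) (hμT : μ ≤ T)
    {f : MvPowerSeries (Fin 2) (Module.End k A)} (hf : constantCoeff f = 1)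
    (hlead : ∀ ν ≤ T, ν ≠ 0 → w ν < w μ → coeff ν f = 0)
    {g : MvPowerSeries Unit (Module.End k A)} (hg : constantCoeff g = 1)
    (hfg : coeff (Finsupp.single () 1) g = coeff μ f) {ν : Fin 2 →₀ ℕ} (hν : ν ≤ T)
    (hν0 : ν ≠ 0) (hνμ : w ν < w μ + 1) :
    coeff ν (inv (subst (monomial μ 1) g) * f) = 0 := by
  refine coeff_inv_mul_eq_zero (constantCoeff_subst hg) hν0 fun ν' hν' => ?_
  by_cases h0 : ν' = 0
  · rw [h0, coeff_zero_eq_constantCoeff_apply, coeff_zero_eq_constantCoeff_apply, hf,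
      constantCoeff_subst hg]
  rcases Nat.lt_succ_iff_lt_or_eq.1 (lt_of_le_of_lt (weight_mono w hν') hνμ) with h | h
  · rw [hlead ν' (hν'.trans hν) h0 h, coeff_subst_monomial_of_ne]
    rintro n rfl
    rcases Nat.eq_zero_or_pos n with rfl | hn
    · simp at h0
    · rw [map_nsmul, smul_eq_mul] at h
      exact absurd h (not_lt.2 (Nat.le_mul_of_pos_left _ hn))
  · have : ν' = μ := hw (hν'.trans hν) hμT h
    have h1 := coeff_subst_monomial hμ (1 : k) g 1
    rw [one_smul, one_pow, one_smul] at h1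
    rw [this, h1, hfg]

/-- Factoring a series into substitutions of families in one variable bounds its obstruction. -/
lemma defect_mem_of_factors {w : (Fin 2 →₀ ℕ) →+ ℕ} {T : Fin 2 →₀ ℕ}
    (hw : Set.InjOn w (Set.Iic T)) {B : AddSubgroup (A → A → A)} (m : ℕ)
    (hB : ∀ (r : ℕ) (ν : Fin 2 →₀ ℕ), r • ν = T → m ≤ w ν → obs k A r ≤ B)
    (hlen : ∀ (q : ℕ) (ν : Fin 2 →₀ ℕ), ν ≠ 0 → m ≤ w ν → q • ν < T →
      LeadingIntegrable k A q)
    {f : MvPowerSeries (Fin 2) (Module.End k A)} (hf : HSOn f (Set.Iio T))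
    (hlead : ∀ ν ≤ T, ν ≠ 0 → w ν < m → coeff ν f = 0) : defect f T ∈ B := by
  classical
  by_cases hT : T = 0
  · rw [hT, defect_zero hf.1]; exact zero_mem B
  induction hd : w T + 1 - m generalizing m f with
  | zero =>
    have h0 : ∀ ν ≤ T, ν ≠ 0 → coeff ν f = 0 := fun ν hν hν0 =>
      hlead ν hν hν0 (lt_of_le_of_lt (weight_mono w hν) (by omega))
    have h1 : ∀ ν ≤ T, coeff ν f = coeff ν (1 : MvPowerSeries (Fin 2) (Module.End k A)) := by
      intro ν hν
      by_cases hν0 : ν = 0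
      · rw [hν0, hf.coeff_zero, coeff_zero_one]
      · rw [h0 ν hν hν0, coeff_one, if_neg hν0]
    rw [defect_congr h1, defect_one]
    exact zero_mem B
  | succ d ih =>
    have next := @ih (m + 1) (fun r ν h h' => hB r ν h (by omega))
      (fun q ν h h' => hlen q ν h (by omega))
    by_cases hμ : ∃ μ ≤ T, μ ≠ 0 ∧ w μ = m
    · obtain ⟨μ, hμT, hμ0, rfl⟩ := hμ
      have hex : ∃ n : ℕ, ¬ n • μ < T := by
        refine ⟨T.degree + 1, fun h => ?_⟩
        have := Finsupp.degree_mono h.le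
        have := le_degree_nsmul hμ0 (T.degree + 1)
        omega
      obtain ⟨q, hq, hqmin⟩ : ∃ q : ℕ, ¬ (q + 1) • μ < T ∧ ∀ n ≤ q, n • μ < T := by
        have hpos : Nat.find hex ≠ 0 := by
          intro h
          have := Nat.find_spec hex
          rw [h, zero_smul] at this
          exact this (pos_iff_ne_zero.2 hT)
        refine ⟨Nat.find hex - 1, ?_, fun n hn => ?_⟩
        · have := Nat.find_spec hex
          rwa [show Nat.find hex - 1 + 1 = Nat.find hex by omega]
        · exact not_not.1 (Nat.find_min hex (by omega))
      have hqT := hqmin q le_rfl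
      obtain ⟨g, hg, hg1⟩ := hlen q μ hμ0 le_rfl hqT w μ f hμ0
        (hw.mono (Set.Iic_subset_Iic.2 hqT.le))
        (hf.mono fun ν hν => lt_of_le_of_lt hν hqT)
        (fun ν hν => hlead ν (hν.trans hqT.le))
      have hP : HSOn (subst (monomial μ 1) g) (Set.Iio T) := by
        refine hg.subst_monomial hμ0 1 fun n hn => ?_
        by_contra hlt
        refine hq (lt_of_le_of_lt ?_ hn)
        exact nsmul_le_nsmul_left zero_le (by omega)
      have hPinv := hP.inv (isLowerSet_Iio T)
      have hmem := next (hPinv.mul (isLowerSet_Iio T) hf)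
        (fun ν hν hν0 hνμ => coeff_inv_subst_mul_eq_zero hw hμ0 hμT hf.1 hlead hg.1 hg1
          hν hν0 hνμ) (by omega)
      rw [defect_mul hPinv hf, defect_inv hP] at hmem
      have hPB : defect (subst (monomial μ 1) g) T ∈ B := by
        by_cases hn : ∃ n : ℕ, T = n • μ
        · obtain ⟨n, hn⟩ := hn
          have hnq : n = q + 1 := by
            have h1 : ¬ n ≤ q := fun h => (hqmin n h).ne hn.symm
            have h2 : ¬ q + 1 < n := fun h => hq <| by
              rw [hn]
              refine lt_of_le_of_ne (nsmul_le_nsmul_left zero_le h.le) fun h' => ?_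
              exact h.ne ((nsmul_inj hμ0).1 h')
            omega
          have : defect (subst (monomial μ (1 : k)) g) T = defect g (Finsupp.single () n) := by
            rw [hn, defect_subst_monomial hμ0, one_pow, one_smul]
          rw [this]
          exact hB n μ hn.symm le_rfl ⟨g, hnq ▸ hg, rfl⟩
        · rw [defect_subst_monomial_of_ne hμ0 1 g (not_exists.1 hn)]
          exact zero_mem B
      simpa using add_mem hPB hmem
    · refine next hf (fun ν hν hν0 hνm => ?_) (by omega)
      refine hlead ν hν hν0 (lt_of_le_of_ne (by omega) fun h => hμ ⟨ν, hν, hν0, h⟩)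

/-- The weight `ν ↦ ν 0 + N * ν 1`. -/
def weight (N : ℕ) : (Fin 2 →₀ ℕ) →+ ℕ where
  toFun ν := ν 0 + N * ν 1
  map_zero' := by simp
  map_add' a b := by simp only [Finsupp.add_apply]; ring

lemma weight_apply (N : ℕ) (ν : Fin 2 →₀ ℕ) : weight N ν = ν 0 + N * ν 1 := rfl

lemma weight_injOn {N : ℕ} {T : Fin 2 →₀ ℕ} (hN : T 0 < N) :
    Set.InjOn (weight N) (Set.Iic T) := by
  intro a ha b hb hab
  have ha' := (le_iff_fin_two.1 ha).1
  have hb' := (le_iff_fin_two.1 hb).1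
  rw [weight_apply, weight_apply] at hab
  have h0 : a 0 = b 0 := by
    have := congrArg (· % N) hab
    simpa [Nat.add_mul_mod_self_left, Nat.mod_eq_of_lt (lt_of_le_of_lt ha' hN),
      Nat.mod_eq_of_lt (lt_of_le_of_lt hb' hN)] using this
  have h1 : a 1 = b 1 := by
    rw [h0] at hab
    exact Nat.eq_of_mul_eq_mul_left (by omega) (Nat.add_left_cancel hab)
  rw [← pt_eta a, ← pt_eta b, h0, h1]

lemma not_dvd_choose_ordProj {p : ℕ} [hp : Fact p.Prime] {r : ℕ} (hr : r ≠ 0) :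
    ¬ p ∣ r.choose (p ^ r.factorization p) := by
  have hu : ¬ p ∣ r / p ^ r.factorization p := Nat.not_dvd_ordCompl hp.out hr
  have hmod := Choose.choose_pow_mul_pow_mul_modEq_choose_nat (p := p)
    (k := r.factorization p) (a := r / p ^ r.factorization p) (b := 1)
  rw [Nat.ordProj_mul_ordCompl_eq_self, mul_one, Nat.choose_one_right] at hmod
  rwa [hmod.dvd_iff dvd_rfl]

lemma obs_le_saturation {p : ℕ} [hp : Fact p.Prime] {r : ℕ} (hr : r ≠ 0)
    (hlen : ∀ q < r, LeadingIntegrable k A q) :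
    obs k A r ≤ saturation p (obs k A (p ^ r.factorization p)) := by
  induction r using Nat.strong_induction_on with
  | _ r ih =>
  set j := p ^ r.factorization p with hj
  have hjr : j ∣ r := Nat.ordProj_dvd r p
  have hj0 : 0 < j := pow_pos hp.out.pos _
  rcases (Nat.le_of_dvd (Nat.pos_of_ne_zero hr) hjr).eq_or_lt with heq | hlt
  · rw [heq]
    exact le_saturation p _
  rintro _ ⟨f, hf, rfl⟩
  refine mem_saturation_of_nsmul_mem (not_dvd_choose_ordProj (p := p) hr) ?_
  rw [← hj]
  set T := pt j (r - j) with hTdef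
  have hT0 : T 0 = j := pt_zero _ _
  have hT1 : T 1 = r - j := pt_one _ _
  have hTdeg : T.degree = r := by rw [degree_fin_two]; omega
  have he0 : (pt 1 0) ≠ 0 := fun h => by simpa using DFunLike.congr_fun h 0
  have he1 : (pt 0 1) ≠ 0 := fun h => by simpa using DFunLike.congr_fun h 1
  have hdeg : ∀ ν < T, ν.degree < r := by
    intro ν hν
    have h1 := le_iff_fin_two.1 hν.le
    have h2 : ¬ (T 0 ≤ ν 0 ∧ T 1 ≤ ν 1) := fun h => hν.not_ge (le_iff_fin_two.2 h)
    rw [degree_fin_two]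
    omega
  have hS : HSOn (subst (X 0 + X 1) f) (Set.Iio T) := hf.subst_X_add_X hdeg
  have hA : HSOn (subst (monomial (pt 1 0) 1) f) (Set.Iio T) :=
    hf.subst_monomial he0 1 fun n hn => (le_degree_nsmul he0 n).trans_lt (hdeg _ hn)
  have hB : HSOn (subst (monomial (pt 0 1) 1) f) (Set.Iio T) :=
    hf.subst_monomial he1 1 fun n hn => (le_degree_nsmul he1 n).trans_lt (hdeg _ hn)
  have hl := isLowerSet_Iio T
  have hmem := defect_mem_of_factors (w := weight (T 0 + 1)) (T := T)
    (weight_injOn (Nat.lt_succ_self _)) (B := saturation p (obs k A j)) 0 ?_ ?_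
    ((hS.inv hl).mul hl (hA.mul hl hB)) (fun _ _ _ h => absurd h (Nat.not_lt_zero _))
  · rw [defect_mul (hS.inv hl) (hA.mul hl hB), defect_mul hA hB, defect_inv hS,
      defect_subst_X_add_X, hTdeg, hT0, defect_subst_monomial_of_ne he0,
      defect_subst_monomial_of_ne he1, add_zero, add_zero] at hmem
    · simpa using neg_mem hmem
    · intro n h
      have := DFunLike.congr_fun h 0
      simp at this
      omega
    · intro n h
      have := DFunLike.congr_fun h 1
      simp at this
      omega
  · intro d ν hd _
    have h0 := DFunLike.congr_fun hd 0
    have h1 := DFunLike.congr_fun hd 1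
    simp only [Finsupp.smul_apply, smul_eq_mul, hT0, hT1] at h0 h1
    have hd0 : d ≠ 0 := by rintro rfl; omega
    have hdj : d ∣ j := ⟨_, h0.symm⟩
    have hdr : d < r := (Nat.le_of_dvd hj0 hdj).trans_lt hlt
    refine (ih d hdr hd0 fun q hq => hlen q (hq.trans hdr)).trans (saturation_mono p ?_)
    exact obs_le_of_dvd ((Nat.ordProj_dvd d p).trans hdj) hj0.ne'
  · intro q ν hν0 _ hq
    exact hlen q ((le_degree_nsmul hν0 q).trans_lt (hdeg _ hq))

theorem leadingIntegrable (q : ℕ) : LeadingIntegrable k A q := by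
  induction q using Nat.strong_induction_on with
  | _ q ih =>
  rcases Nat.eq_zero_or_pos q with rfl | hq
  · intro w μ f _ _ _ _
    exact mem_integrable_one _
  intro w μ f hμ hw hf hlead
  have hle : (q - 1) • μ ≤ q • μ := nsmul_le_nsmul_left zero_le (by omega)
  obtain ⟨g, hg, hg1⟩ := ih (q - 1) (by omega) w μ f hμ (hw.mono (Set.Iic_subset_Iic.2 hle))
    (hf.mono (Set.Iic_subset_Iic.2 hle)) (fun ν hν => hlead ν (hν.trans hle))
  rw [Nat.sub_add_cancel hq] at hg
  rw [← hg1]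
  have hμT : μ ≤ q • μ := by simpa using nsmul_le_nsmul_left (a := μ) zero_le hq
  have hwμ : w μ ≠ 0 := fun h => hμ (hw hμT (Set.mem_Iic.2 zero_le) (by rw [h, map_zero]))
  have hP : HSOn (subst (monomial μ 1) g) (Set.Iio (q • μ)) := by
    refine hg.subst_monomial hμ 1 fun n hn => ?_
    by_contra hlt
    exact (lt_of_lt_of_le (Set.mem_Iio.1 hn) (nsmul_le_nsmul_left zero_le (not_lt.1 hlt))).false
  have hf' : HSOn f (Set.Iio (q • μ)) := hf.mono Set.Iio_subset_Iic_self
  have hPinv := hP.inv (isLowerSet_Iio (q • μ))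
  refine mem_integrable_succ hg (mem_of_forall_mem_saturation fun p hp => ?_)
  by_cases hpow : p ^ q.factorization p = q
  · have hmem := defect_mem_of_factors hw (B := saturation p (obsTwo k A q)) (w μ + 1) ?_ ?_
      (hPinv.mul (isLowerSet_Iio _) hf')
      (fun ν hν hν0 hνμ => coeff_inv_subst_mul_eq_zero hw hμ hμT hf.1 hlead hg.1 hg1 hν hν0 hνμ)
    · rw [defect_mul hPinv hf', defect_inv hP, hf.2 _ (Set.mem_Iic.2 le_rfl), add_zero,
        defect_subst_monomial hμ, one_pow, one_smul] at hmem
      simpa using neg_mem hmem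
    · intro r ν hr hν
      have hwr : r * w ν = q * w μ := by
        simpa only [map_nsmul, smul_eq_mul] using congrArg w hr
      have hr0 : r ≠ 0 := by
        rintro rfl
        rw [zero_mul] at hwr
        exact (Nat.mul_ne_zero hq.ne' hwμ) hwr.symm
      have hrq : r < q := by
        by_contra hge
        have h1 : q * w μ ≤ r * w μ := Nat.mul_le_mul_right _ (not_lt.1 hge)
        have h2 : r * (w μ + 1) ≤ r * w ν := Nat.mul_le_mul_left _ hν
        have h3 : r * (w μ + 1) = r * w μ + r := by ring
        omega
      have hlt : p ^ r.factorization p < q :=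
        (Nat.le_of_dvd (Nat.pos_of_ne_zero hr0) (Nat.ordProj_dvd r p)).trans_lt hrq
      refine (obs_le_saturation (p := p) hr0 fun q' hq' => ih q' (hq'.trans hrq)).trans
        (saturation_mono p (obs_le_obsTwo ?_ hlt))
      rw [← hpow] at hlt ⊢
      exact pow_dvd_pow p ((Nat.pow_lt_pow_iff_right hp.out.one_lt).1 hlt).le
    · intro q' ν _ hν hq'
      refine ih q' ?_
      by_contra hge
      have h0 := weight_mono w hq'.le
      simp only [map_nsmul, smul_eq_mul] at h0
      have h1 : q * w μ ≤ q' * w μ := Nat.mul_le_mul_right _ (not_lt.1 hge)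
      have h2 : q' * (w μ + 1) ≤ q' * w ν := Nat.mul_le_mul_left _ hν
      have h3 : q' * (w μ + 1) = q' * w μ + q' := by ring
      omega
  · refine saturation_mono p (obs_le_obsTwo (Nat.ordProj_dvd q p) ?_)
      (obs_le_saturation hq.ne' ih ⟨g, hg, rfl⟩)
    exact lt_of_le_of_ne (Nat.le_of_dvd hq (Nat.ordProj_dvd q p)) hpow


lemma pt_one_zero_ne_zero : pt 1 0 ≠ 0 := fun h => by simpa using DFunLike.congr_fun h 0

lemma pt_zero_one_ne_zero : pt 0 1 ≠ 0 := fun h => by simpa using DFunLike.congr_fun h 1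

lemma nsmul_pt (n a b : ℕ) : n • pt a b = pt (n * a) (n * b) := by
  ext i; fin_cases i <;> simp

lemma coeff_subst_left (f : MvPowerSeries Unit (Module.End k A)) (n : ℕ) :
    coeff (pt n 0) (subst (monomial (pt 1 0) 1) f) = coeff (Finsupp.single () n) f := by
  have h := coeff_subst_monomial pt_one_zero_ne_zero (1 : k) f n
  rwa [nsmul_pt, mul_one, mul_zero, one_pow, one_smul] at h

lemma coeff_subst_left_of_ne (f : MvPowerSeries Unit (Module.End k A)) {ν : Fin 2 →₀ ℕ}
    (hν : ν 1 ≠ 0) : coeff ν (subst (monomial (pt 1 0) 1) f) = 0 := by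
  refine coeff_subst_monomial_of_ne 1 f ?_
  rintro n rfl
  simp at hν

lemma coeff_subst_right (f : MvPowerSeries Unit (Module.End k A)) (n : ℕ) :
    coeff (pt 0 n) (subst (monomial (pt 0 1) 1) f) = coeff (Finsupp.single () n) f := by
  have h := coeff_subst_monomial pt_zero_one_ne_zero (1 : k) f n
  rwa [nsmul_pt, mul_one, mul_zero, one_pow, one_smul] at h

lemma coeff_subst_right_of_ne (f : MvPowerSeries Unit (Module.End k A)) {ν : Fin 2 →₀ ℕ}
    (hν : ν 0 ≠ 0) : coeff ν (subst (monomial (pt 0 1) 1) f) = 0 := by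
  refine coeff_subst_monomial_of_ne 1 f ?_
  rintro n rfl
  simp at hν

/-- The leading coefficient of a family in one variable is integrable. -/
lemma coeff_mem_integrable {f : MvPowerSeries Unit (Module.End k A)} {n q : ℕ} (hn : n ≠ 0)
    (hf : HSOn f (Set.Iio (Finsupp.single () (q * n + 1))))
    (hlead : ∀ i, i ≠ 0 → i < n → coeff (Finsupp.single () i) f = 0) :
    coeff (Finsupp.single () n) f ∈ integrable k A (q + 1) := by
  have hT : q • pt n 0 = pt (q * n) 0 := by rw [nsmul_pt, mul_zero]
  rw [← coeff_subst_left]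
  refine leadingIntegrable q (weight (q * n + 1)) (pt n 0) _ ?_ ?_ ?_ ?_
  · intro h
    exact hn (by simpa using DFunLike.congr_fun h 0)
  · rw [hT]
    exact weight_injOn (by simp)
  · refine hf.subst_monomial pt_one_zero_ne_zero 1 fun m hm => ?_
    rw [hT, Set.mem_Iic, nsmul_pt, le_iff_fin_two] at hm
    simp at hm
    omega
  · intro ν hν hν0 hw
    rw [hT, le_iff_fin_two] at hν
    simp only [pt_zero, pt_one, nonpos_iff_eq_zero] at hν
    have hνe : ν = pt (ν 0) 0 := by rw [← hν.2, pt_eta]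
    simp only [weight_apply, pt_zero, pt_one, hν.2, mul_zero, add_zero] at hw
    rw [hνe, coeff_subst_left]
    refine hlead _ (fun h => hν0 ?_) hw
    rw [hνe, h]
    simp [pt]

lemma coeff_subst_mul_subst (f g : MvPowerSeries Unit (Module.End k A)) (i j : ℕ) :
    coeff (pt i j) (subst (monomial (pt 1 0) 1) f * subst (monomial (pt 0 1) 1) g) =
      coeff (Finsupp.single () i) f * coeff (Finsupp.single () j) g := by
  rw [coeff_mul, Finset.sum_eq_single (pt i 0, pt 0 j)]
  · rw [coeff_subst_left, coeff_subst_right]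
  · rintro ⟨a, b⟩ hab hne
    rw [HasAntidiagonal.mem_antidiagonal] at hab
    have h0 := DFunLike.congr_fun hab 0
    have h1 := DFunLike.congr_fun hab 1
    simp only [Finsupp.add_apply, pt_zero, pt_one] at h0 h1
    by_cases ha : a 1 = 0
    · by_cases hb : b 0 = 0
      · refine absurd ?_ hne
        rw [← pt_eta a, ← pt_eta b, ha, hb]
        congr 2 <;> omega
      · rw [coeff_subst_right_of_ne g hb, mul_zero]
    · rw [coeff_subst_left_of_ne f ha, zero_mul]
  · intro h
    refine absurd ?_ h
    rw [HasAntidiagonal.mem_antidiagonal]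
    ext l; fin_cases l <;> simp

lemma coeff_subst_mul_subst_swap (f g : MvPowerSeries Unit (Module.End k A)) (i j : ℕ) :
    coeff (pt i j) (subst (monomial (pt 0 1) 1) g * subst (monomial (pt 1 0) 1) f) =
      coeff (Finsupp.single () j) g * coeff (Finsupp.single () i) f := by
  rw [coeff_mul, Finset.sum_eq_single (pt 0 j, pt i 0)]
  · rw [coeff_subst_left, coeff_subst_right]
  · rintro ⟨b, a⟩ hab hne
    rw [HasAntidiagonal.mem_antidiagonal] at hab
    have h0 := DFunLike.congr_fun hab 0
    have h1 := DFunLike.congr_fun hab 1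
    simp only [Finsupp.add_apply, pt_zero, pt_one] at h0 h1
    by_cases ha : a 1 = 0
    · by_cases hb : b 0 = 0
      · refine absurd ?_ hne
        rw [← pt_eta a, ← pt_eta b, ha, hb]
        congr 2 <;> omega
      · rw [coeff_subst_right_of_ne g hb, zero_mul]
    · rw [coeff_subst_left_of_ne f ha, mul_zero]
  · intro h
    refine absurd ?_ h
    rw [HasAntidiagonal.mem_antidiagonal]
    ext l; fin_cases l <;> simp

lemma commutator_mem_integrable {f g : MvPowerSeries Unit (Module.End k A)}
    (hf : HSOn f Set.univ) (hg : HSOn g Set.univ) (q : ℕ) :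
    coeff (Finsupp.single () 1) f * coeff (Finsupp.single () 1) g -
      coeff (Finsupp.single () 1) g * coeff (Finsupp.single () 1) f ∈ integrable k A (q + 1) := by
  have hF : HSOn (subst (monomial (pt 1 0) 1) f) Set.univ :=
    ⟨constantCoeff_subst hf.1, fun ν _ => by
      funext x y
      rw [defect_subst (constantCoeff_monomial pt_one_zero_ne_zero 1)]
      exact Finset.sum_eq_zero fun n _ => by rw [hf.2 _ trivial]; simp⟩
  have hG : HSOn (subst (monomial (pt 0 1) 1) g) Set.univ :=
    ⟨constantCoeff_subst hg.1, fun ν _ => by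
      funext x y
      rw [defect_subst (constantCoeff_monomial pt_zero_one_ne_zero 1)]
      exact Finset.sum_eq_zero fun n _ => by rw [hg.2 _ trivial]; simp⟩
  have hY := hG.mul isLowerSet_univ hF
  have hX := hF.mul isLowerSet_univ hG
  have f0 : coeff (Finsupp.single () 0) f = 1 := by rw [Finsupp.single_zero]; exact hf.1
  have g0 : coeff (Finsupp.single () 0) g = 1 := by rw [Finsupp.single_zero]; exact hg.1
  have hXY : ∀ ν : Fin 2 →₀ ℕ, ν 0 = 0 ∨ ν 1 = 0 →
      coeff ν (subst (monomial (pt 1 0) 1) f * subst (monomial (pt 0 1) 1) g) =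
      coeff ν (subst (monomial (pt 0 1) 1) g * subst (monomial (pt 1 0) 1) f) := by
    intro ν hν
    rw [← pt_eta ν, coeff_subst_mul_subst, coeff_subst_mul_subst_swap]
    rcases hν with h | h
    · rw [h, f0, one_mul, mul_one]
    · rw [h, g0, one_mul, mul_one]
  have h11 : pt 1 1 ≠ 0 := fun h => by simpa using DFunLike.congr_fun h 0
  have hlt : ∀ ν' < pt 1 1, ν' 0 = 0 ∨ ν' 1 = 0 := by
    intro ν' hν'
    have h1 := le_iff_fin_two.1 hν'.le
    have h2 : ¬ (pt 1 1 0 ≤ ν' 0 ∧ pt 1 1 1 ≤ ν' 1) := fun h => hν'.not_ge (le_iff_fin_two.2 h)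
    simp only [pt_zero, pt_one] at h1 h2
    omega
  have hlead := coeff_inv_mul hY.1 h11 fun ν' hν' => hXY ν' (hlt ν' hν')
  rw [coeff_subst_mul_subst, coeff_subst_mul_subst_swap] at hlead
  rw [← hlead]
  have hT : q • pt 1 1 = pt q q := by rw [nsmul_pt, mul_one]
  refine leadingIntegrable q (weight (q + 1)) (pt 1 1) _ h11 ?_
    (((hY.inv isLowerSet_univ).mul isLowerSet_univ hX).mono (Set.subset_univ _)) ?_
  · rw [hT]
    exact weight_injOn (by simp)
  · intro ν hν hν0 hw
    rw [hT, le_iff_fin_two] at hν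
    simp only [pt_zero, pt_one] at hν
    simp only [weight_apply, pt_zero, pt_one] at hw
    have h : ν 0 = 0 ∨ ν 1 = 0 := by
      by_contra! h
      have : (q + 1) * 1 ≤ (q + 1) * ν 1 := Nat.mul_le_mul_left _ (by omega)
      omega
    refine coeff_inv_mul_eq_zero hY.1 hν0 fun ν' hν' => hXY ν' ?_
    have := le_iff_fin_two.1 hν'
    omega

lemma exists_integrable_le [IsArtinianRing k] [Module.Finite k A] :
    ∃ N, ∀ m, integrable k A N ≤ integrable k A m := by
  have : IsNoetherian k (Module.End k A) := inferInstance
  have : Module.Finite k (Module.End k A) := inferInstance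
  obtain ⟨N, hN⟩ := IsArtinian.monotone_stabilizes (R := k) (M := Module.End k A)
    ⟨fun n => OrderDual.toDual (integrable k A n), fun _ _ h => integrable_antitone h⟩
  refine ⟨N, fun m => ?_⟩
  rcases le_total N m with h | h
  · exact (congrArg OrderDual.ofDual (hN m h)).le
  · exact integrable_antitone h

/-- The coefficients of `f` in degrees below `n` extend to families of every finite length. -/
def Extendable (n : ℕ) (f : MvPowerSeries Unit (Module.End k A)) : Prop :=
  ∀ m, ∃ g, HSOn g (Set.Iio (Finsupp.single () m)) ∧
    ∀ i < n, coeff (Finsupp.single () i) g = coeff (Finsupp.single () i) f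

lemma le_single_iff {ν : Unit →₀ ℕ} {n : ℕ} :
    ν ≤ Finsupp.single () n ↔ ∃ i ≤ n, ν = Finsupp.single () i := by
  constructor
  · intro h
    exact ⟨ν (), by simpa using h (), by ext; simp⟩
  · rintro ⟨i, hi, rfl⟩
    simpa using hi

lemma Extendable.exists_succ [IsArtinianRing k] [Module.Finite k A] {n : ℕ} (hn : n ≠ 0)
    {f : MvPowerSeries Unit (Module.End k A)} (hf : Extendable n f) :
    ∃ g, Extendable (n + 1) g ∧
      ∀ i < n, coeff (Finsupp.single () i) g = coeff (Finsupp.single () i) f := by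
  obtain ⟨N, hN⟩ := exists_integrable_le (k := k) (A := A)
  obtain ⟨g, hg, hgf⟩ := hf (N * n + 1)
  refine ⟨g, fun m => ?_, hgf⟩
  obtain ⟨h, hh, hhf⟩ := hf (max m (N * n + 1))
  have hh' : HSOn h (Set.Iio (Finsupp.single () (N * n + 1))) :=
    hh.mono (Set.Iio_subset_Iio (Finsupp.single_mono (le_max_right _ _)))
  have hgh : ∀ i < n, ∀ ν' ≤ Finsupp.single () i, coeff ν' g = coeff ν' h := by
    intro i hi ν' hν'
    obtain ⟨j, hj, rfl⟩ := le_single_iff.1 hν'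
    rw [hgf j (by omega), hhf j (by omega)]
  have hzero : ∀ i, i ≠ 0 → i < n → coeff (Finsupp.single () i) (inv h * g) = 0 :=
    fun i hi0 hin => coeff_inv_mul_eq_zero hh.1 (single_ne_zero hi0) (hgh i hin)
  have hmem : coeff (Finsupp.single () n) (inv h * g) ∈ integrable k A m :=
    hN m (integrable_antitone (Nat.le_succ N) (coeff_mem_integrable hn
      ((hh'.inv (isLowerSet_Iio _)).mul (isLowerSet_Iio _) hg) hzero))
  obtain ⟨e, he, he1⟩ := hmem
  have hn0 := single_ne_zero hn
  have hS : HSOn (subst (monomial (Finsupp.single () n) 1) e) (Set.Iio (Finsupp.single () m)) := by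
    refine he.subst_monomial hn0 1 fun j hj => ?_
    rw [Set.mem_Iio, lt_single_iff] at hj
    simp only [Finsupp.smul_single, Finsupp.single_eq_same, smul_eq_mul] at hj
    exact (Nat.le_mul_of_pos_right j (Nat.pos_of_ne_zero hn)).trans_lt hj
  refine ⟨h * subst (monomial (Finsupp.single () n) 1) e,
    (hh.mono (Set.Iio_subset_Iio (Finsupp.single_mono (le_max_left _ _)))).mul (isLowerSet_Iio _) hS,
    fun i hi => ?_⟩
  have hcancel : g = h * (inv h * g) := by rw [← mul_assoc, mul_inv hh.1, one_mul]
  conv_rhs => rw [hcancel]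
  refine coeff_mul_congr h fun ν' hν' => ?_
  obtain ⟨j, hj, rfl⟩ := le_single_iff.1 hν'
  rcases Nat.eq_zero_or_pos j with rfl | hj0
  · rw [Finsupp.single_zero, hS.coeff_zero, coeff_zero_eq_constantCoeff_apply, map_mul,
      constantCoeff_inv, hg.1, one_mul]
  rcases Nat.lt_succ_iff_lt_or_eq.1 (hj.trans_lt hi) with hjn | rfl
  · rw [hzero j hj0.ne' hjn]
    refine coeff_subst_monomial_of_ne 1 e fun l hl => ?_
    have := DFunLike.congr_fun hl ()
    simp only [Finsupp.smul_single, Finsupp.single_eq_same, smul_eq_mul] at this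
    rcases Nat.eq_zero_or_pos l with rfl | hl0
    · omega
    · have := Nat.le_mul_of_pos_left n hl0
      omega
  · have := coeff_subst_monomial hn0 (1 : k) e 1
    rw [one_smul, one_pow, one_smul, he1] at this
    exact this

lemma exists_HSOn_univ [IsArtinianRing k] [Module.Finite k A] {D : Module.End k A}
    (hD : ∀ m, D ∈ integrable k A m) :
    ∃ f : MvPowerSeries Unit (Module.End k A), HSOn f Set.univ ∧
      coeff (Finsupp.single () 1) f = D := by
  obtain ⟨f₀, hf₀, hf₀D⟩ := hD 0
  have hext : Extendable 2 f₀ := by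
    intro m
    obtain ⟨g, hg, hgD⟩ := hD m
    refine ⟨g, hg, fun i hi => ?_⟩
    interval_cases i
    · rw [Finsupp.single_zero, hg.coeff_zero, hf₀.coeff_zero]
    · rw [hgD, hf₀D]
  choose next hnext hagree using fun (n : ℕ)
    (f : {f : MvPowerSeries Unit (Module.End k A) // Extendable (n + 2) f}) =>
    f.2.exists_succ (Nat.succ_ne_zero (n + 1))
  let F : (n : ℕ) → {f : MvPowerSeries Unit (Module.End k A) // Extendable (n + 2) f} :=
    fun n => Nat.rec ⟨f₀, hext⟩ (fun n f => ⟨next n f, hnext n f⟩) n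
  have hF : ∀ i n, i ≤ n →
      coeff (Finsupp.single () i) (F n).1 = coeff (Finsupp.single () i) (F i).1 := by
    intro i n hin
    induction n, hin using Nat.le_induction with
    | base => rfl
    | succ n hin ih => exact (hagree n (F n) i (by omega)).trans ih
  let Φ : MvPowerSeries Unit (Module.End k A) := fun ν => coeff ν (F (ν ())).1
  have hΦ : ∀ i, coeff (Finsupp.single () i) Φ = coeff (Finsupp.single () i) (F i).1 := by
    intro i
    change coeff (Finsupp.single () i) (F (Finsupp.single () i ())).1 = _
    rw [Finsupp.single_eq_same]
  refine ⟨Φ, ⟨?_, fun ν _ => ?_⟩, ?_⟩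
  · have h0 := hΦ 0
    rw [Finsupp.single_zero] at h0
    exact h0.trans hf₀.coeff_zero
  · obtain ⟨g, hg, hgF⟩ := (F (ν ())).2 (ν () + 1)
    rw [← hg.2 ν (lt_single_iff.2 (Nat.lt_succ_self _))]
    refine defect_congr fun ν' hν' => ?_
    have hν : ν = Finsupp.single () (ν ()) := by ext; simp
    rw [hν] at hν'
    obtain ⟨i, hi, rfl⟩ := le_single_iff.1 hν'
    rw [hΦ, hgF i (by omega), hF i _ hi]
  · exact (hΦ 1).trans ((hagree 0 (F 0) 1 (by omega)).trans hf₀D)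

lemma isInfIntegrable_one_iff {D : Module.End k A} :
    IsInfIntegrable k A 1 D ↔ ∃ f : MvPowerSeries Unit (Module.End k A),
      HSOn f Set.univ ∧ coeff (Finsupp.single () 1) f = D := by
  classical
  have key : ∀ (f : MvPowerSeries Unit (Module.End k A)) (n : ℕ) (x y : A),
      defect f (Finsupp.single () n) x y = coeff (Finsupp.single () n) f (x * y) -
        ∑ j ∈ range (n + 1), coeff (Finsupp.single () j) f x *
          coeff (Finsupp.single () (n - j)) f y := by
    intro f n x y
    unfold defect
    rw [sum_antidiagonal_single n (fun a b => coeff a f x * coeff b f y),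
      Finset.Nat.sum_antidiagonal_eq_sum_range_succ_mk]
  constructor
  · rintro ⟨α, h0, -, h1, h⟩
    let f : MvPowerSeries Unit (Module.End k A) := fun ν => α (ν ())
    have hf : ∀ n, coeff (Finsupp.single () n) f = α n := by
      intro n
      change α (Finsupp.single () n ()) = α n
      rw [Finsupp.single_eq_same]
    refine ⟨f, ⟨h0, fun ν _ => ?_⟩, (hf 1).trans h1⟩
    have hν : ν = Finsupp.single () (ν ()) := by ext; simp
    funext x y
    rw [hν, key]
    simp only [hf, h, sub_self, Pi.zero_apply]
  · rintro ⟨f, hf, hD⟩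
    refine ⟨fun n => coeff (Finsupp.single () n) f, ?_, fun i _ _ => by omega, hD,
      fun n x y => ?_⟩
    · change coeff (Finsupp.single () 0) f = 1
      rw [Finsupp.single_zero, hf.coeff_zero]
    · have h := key f n x y
      rw [hf.2 _ trivial] at h
      exact sub_eq_zero.1 h.symm

lemma isDerivation_commutator {D D' : A →ₗ[k] A} (hD : IsDerivation k A D)
    (hD' : IsDerivation k A D') : IsDerivation k A (D ∘ₗ D' - D' ∘ₗ D) := by
  intro x y
  simp only [LinearMap.sub_apply, LinearMap.comp_apply, hD x y, hD' x y, map_add, hD _ _, hD' _ _,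
    sub_mul, mul_sub]
  abel

end HasseSchmidt

/-- For an Artin algebra `A` over a commutative Artinian ring `k`, the
commutator of two integrable (`[1,∞]`-integrable) derivations is an integrable
derivation: the integrable derivations form a Lie subalgebra of `Der(A)`. -/
theorem statement8 (k : Type*) [CommRing k] [IsArtinianRing k]
    (A : Type*) [Ring A] [Algebra k A] [Module.Finite k A]
    (D D' : A →ₗ[k] A) (hD : IsDerivation k A D) (hD' : IsDerivation k A D')
    (h1 : IsInfIntegrable k A 1 D) (h2 : IsInfIntegrable k A 1 D') :
    IsDerivation k A (D ∘ₗ D' - D' ∘ₗ D) ∧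
    IsInfIntegrable k A 1 (D ∘ₗ D' - D' ∘ₗ D) := by
  obtain ⟨f, hf, rfl⟩ := HasseSchmidt.isInfIntegrable_one_iff.1 h1
  obtain ⟨g, hg, rfl⟩ := HasseSchmidt.isInfIntegrable_one_iff.1 h2
  refine ⟨HasseSchmidt.isDerivation_commutator hD hD',
    HasseSchmidt.isInfIntegrable_one_iff.2 (HasseSchmidt.exists_HSOn_univ fun m => ?_)⟩
  exact HasseSchmidt.integrable_antitone (Nat.le_succ m)
    (HasseSchmidt.commutator_mem_integrable hf hg m)
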